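/- arXiv:2506.17907 — 4 statements merged into one kernel-verified Lean document; each statement's English description precedes it below -/
import Mathlib

section
/- Let F be a totally real number field, let v be a finite place of F with completion F_v, let k ≥ 1 be an integer, let d₁, …, d_k ∈ F_v^×, and let ε₁, …, ε_k ∈ {+1, −1}. Then there exist D₁, …, D_k ∈ F^× such that: (i) for each i, the element D_i · d_i^{−1} is a square in F_v^×; (ii) for each i and every ring homomorphism τ : F → ℝ, one has ε_i · τ(D_i) > 0; (iii) for all subsets S, T ⊆ {1, …, k}, if (∏_{i∈S} D_i) · (∏_{i∈T} D_i)^{−1} is a square in F^×, then S = T; equivalently, the classes of D₁, …, D_k in F^×/(F^×)² are linearly independent over 𝔽₂. -/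
open IsDedekindDomain NumberField Topology WithZero

/-- In a complete nontrivially normed field of characteristic zero, the elements in the square
class of `a ≠ 0` form a neighbourhood of `a`. -/
theorem setOf_mul_sq_mem_nhds {L : Type*} [NontriviallyNormedField L] [CompleteSpace L]
    [CharZero L] {a : L} (ha : a ≠ 0) : {x : L | ∃ y, y ≠ 0 ∧ x = a * y ^ 2} ∈ 𝓝 a := by
  have hderiv : HasStrictDerivAt (fun y : L => a * y ^ 2) (a * 2) 1 := by
    simpa using ((hasStrictDerivAt_id (1 : L)).pow 2).const_mul a
  have hmap := hderiv.map_nhds_eq (mul_ne_zero ha two_ne_zero)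
  simp only [one_pow, mul_one] at hmap
  rw [← hmap, Filter.mem_map]
  filter_upwards [isOpen_ne.mem_nhds (one_ne_zero (α := L))] with y hy
  exact ⟨y, hy, rfl⟩

section NumberField

variable {F : Type*} [Field F] [NumberField F]

theorem adicCompletion_setOf_mul_sq_mem_nhds (v : HeightOneSpectrum (𝓞 F))
    {a : v.adicCompletion F} (ha : a ≠ 0) :
    {x : v.adicCompletion F | ∃ y, y ≠ 0 ∧ x = a * y ^ 2} ∈ 𝓝 a := by
  let _ : NontriviallyNormedField (v.adicCompletion F) :=
    Valued.toNontriviallyNormedField (L := v.adicCompletion F) (Γ₀ := ℤᵐ⁰)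
  have : CharZero (v.adicCompletion F) :=
    charZero_of_injective_algebraMap (algebraMap F (v.adicCompletion F)).injective
  exact setOf_mul_sq_mem_nhds ha

/-- Every neighbourhood of an integer `a` in `F_v` contains all integers congruent to `a` modulo
a high enough power of `v`. -/
theorem exists_pow_forall_sub_mem_of_mem_nhds (v : HeightOneSpectrum (𝓞 F)) (a : 𝓞 F)
    {U : Set (v.adicCompletion F)} (hU : U ∈ 𝓝 (algebraMap F (v.adicCompletion F) a)) :
    ∃ N : ℕ, ∀ b : 𝓞 F, b - a ∈ v.asIdeal ^ N → algebraMap F (v.adicCompletion F) b ∈ U := by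
  obtain ⟨γ, hγ⟩ := Valued.mem_nhds.1 hU
  have hne : MonoidWithZeroHom.ValueGroup₀.embedding γ.1 ≠ 0 := by simp
  set e := MonoidWithZeroHom.ValueGroup₀.embedding γ.1 with he
  refine ⟨(1 - log e).toNat, fun b hb => hγ ?_⟩
  have hval : Valued.v (algebraMap F (v.adicCompletion F) b - algebraMap F (v.adicCompletion F) a)
      = v.intValuation (b - a) := by
    rw [← map_sub, ← map_sub, ← v.valuation_of_algebraMap (K := F)]
    exact HeightOneSpectrum.adicCompletion.valued_coe ..
  rw [Set.mem_ofPred_eq, Valuation.restrict_lt_iff_lt_embedding, hval]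
  refine ((v.intValuation_le_pow_iff_mem _ _).2 hb).trans_lt ?_
  rw [← he, ← lt_log_iff_exp_lt hne]
  omega

/-- Every square class of `F_v` is represented by an integer `a`, and by every integer
sufficiently close to `a`. -/
theorem exists_forall_sub_mem_pow_square_class (v : HeightOneSpectrum (𝓞 F))
    {d : v.adicCompletion F} (hd : d ≠ 0) :
    ∃ (a : 𝓞 F) (N : ℕ), ∀ b : 𝓞 F, b - a ∈ v.asIdeal ^ N →
      ∃ y : v.adicCompletion F, y ≠ 0 ∧ algebraMap F (v.adicCompletion F) b * d⁻¹ = y ^ 2 := by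
  obtain ⟨x, y, hy, hx⟩ := (HeightOneSpectrum.denseRange_algebraMap (R := 𝓞 F) F v).exists_mem_open
    isOpen_interior ⟨d, mem_interior_iff_mem_nhds.2 (adicCompletion_setOf_mul_sq_mem_nhds v hd)⟩
    |>.imp fun _ h => interior_subset h
  obtain ⟨r, s, hs, rfl⟩ := IsFractionRing.div_surjective (A := 𝓞 F) x
  set φ := algebraMap F (v.adicCompletion F)
  have hs0 : (s : F) ≠ 0 := by simpa using nonZeroDivisors.ne_zero hs
  have hφs : φ s ≠ 0 := by simpa using hs0
  have ha : φ (r * s : 𝓞 F) = d * (y * φ s) ^ 2 := by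
    have : φ r = d * y ^ 2 * φ s := by
      rw [← hx, map_div₀]; exact (div_mul_cancel₀ _ hφs).symm
    rw [show ((r * s : 𝓞 F) : F) = r * s from map_mul (algebraMap (𝓞 F) F) r s, map_mul, this]
    ring
  have ha0 : φ (r * s : 𝓞 F) ≠ 0 := by
    rw [ha]; exact mul_ne_zero hd (pow_ne_zero _ (mul_ne_zero hy hφs))
  obtain ⟨N, hN⟩ := exists_pow_forall_sub_mem_of_mem_nhds v (r * s)
    (adicCompletion_setOf_mul_sq_mem_nhds v ha0)
  refine ⟨r * s, N, fun b hb => ?_⟩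
  obtain ⟨z, hz, hbz⟩ := hN b hb
  refine ⟨y * φ s * z, mul_ne_zero (mul_ne_zero hy hφs) hz, ?_⟩
  rw [hbz, ha]
  field_simp

/-- Every residue class modulo a nonzero ideal contains an element with a prescribed common sign
at all real embeddings. -/
theorem exists_sub_mem_forall_sign {I : Ideal (𝓞 F)} (hI : I ≠ ⊥) (c : 𝓞 F) {ε : ℝ}
    (hε : ε = 1 ∨ ε = -1) : ∃ b : 𝓞 F, b - c ∈ I ∧ ∀ τ : F →+* ℝ, 0 < ε * τ b := by
  obtain ⟨s, rfl⟩ : ∃ s : ℤ, ε = s := by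
    rcases hε with rfl | rfl
    exacts [⟨1, by simp⟩, ⟨-1, by simp⟩]
  have hss : (s : ℝ) * s = 1 := by rcases hε with h | h <;> rw [h] <;> norm_num
  have : Finite (F →+* ℝ) := Finite.of_injective (fun τ => Complex.ofRealHom.comp τ)
    fun τ σ h => RingHom.ext fun x => Complex.ofReal_injective (RingHom.congr_fun h x)
  obtain ⟨B, hB⟩ := (Set.finite_range fun τ : F →+* ℝ => -(s * τ c)).bddAbove
  obtain ⟨m, hm⟩ := exists_nat_gt B
  have hn : 1 ≤ Ideal.absNorm I := Nat.one_le_iff_ne_zero.2 (Ideal.absNorm_eq_zero_iff.not.2 hI)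
  refine ⟨c + s * m * Ideal.absNorm I, ?_, fun τ => ?_⟩
  · rw [add_sub_cancel_left]
    exact I.mul_mem_left _ (Ideal.absNorm_mem I)
  · have h1 : -(s * τ c) < m := (hB ⟨τ, rfl⟩).trans_lt hm
    have h2 : (m : ℝ) ≤ m * Ideal.absNorm I :=
      le_mul_of_one_le_right m.cast_nonneg (mod_cast hn)
    have h3 : (s : ℝ) * τ ((c + s * m * Ideal.absNorm I : 𝓞 F) : F)
        = s * τ c + (s * s) * (m * Ideal.absNorm I) := by
      push_cast
      simp only [map_add, map_mul, map_intCast, map_natCast]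
      ring
    rw [h3, hss]
    linarith

variable (F) in
theorem infinite_heightOneSpectrum_ringOfIntegers : Infinite (HeightOneSpectrum (𝓞 F)) := by
  have h (p : Nat.Primes) : ∃ w : HeightOneSpectrum (𝓞 F),
      w.asIdeal.comap (algebraMap ℤ (𝓞 F)) = Ideal.span {((p : ℕ) : ℤ)} := by
    have hp : Prime ((p : ℕ) : ℤ) := Nat.prime_iff_prime_int.1 p.2
    have : (Ideal.span {((p : ℕ) : ℤ)}).IsMaximal :=
      PrincipalIdealRing.isMaximal_of_irreducible hp.irreducible
    obtain ⟨Q, hQ, hQp⟩ := Ideal.exists_ideal_over_maximal_of_isIntegral (S := 𝓞 F)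
      (Ideal.span {((p : ℕ) : ℤ)}) (by
        rw [(RingHom.injective_iff_ker_eq_bot _).mp (FaithfulSMul.algebraMap_injective ℤ (𝓞 F))]
        exact bot_le)
    refine ⟨⟨Q, hQ.isPrime, ?_⟩, hQp⟩
    rintro rfl
    have hpm : ((p : ℕ) : ℤ) ∈ (⊥ : Ideal (𝓞 F)).comap (algebraMap ℤ (𝓞 F)) :=
      hQp ▸ Ideal.mem_span_singleton_self _
    exact p.2.ne_zero (by simpa using hpm)
  choose w hw using h
  refine Infinite.of_injective w fun p q hpq => ?_
  have := (hw p).symm.trans (hpq ▸ hw q)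
  rw [Ideal.span_singleton_eq_span_singleton, Int.associated_iff_natAbs] at this
  exact Subtype.ext (by simpa using this)

/-- Elements with pairwise separated odd valuations are independent modulo squares. -/
theorem eq_of_prod_mul_inv_prod_eq_sq {R K ι : Type*} [CommRing R] [IsDedekindDomain R]
    [Field K] [Algebra R K] [IsFractionRing R K] {D : ι → K} (w : ι → HeightOneSpectrum R)
    (hself : ∀ i, (w i).valuation K (D i) = exp (-1))
    (hother : ∀ i j, j ≠ i → (w i).valuation K (D j) = 1) {S T : Finset ι} {y : K}
    (hy : (∏ i ∈ S, D i) * (∏ i ∈ T, D i)⁻¹ = y ^ 2) : S = T := by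
  classical
  have hprod (i : ι) (A : Finset ι) :
      (w i).valuation K (∏ j ∈ A, D j) = exp (if i ∈ A then -1 else 0 : ℤ) := by
    rw [map_prod]
    split_ifs with hi
    · rw [Finset.prod_eq_single_of_mem i hi fun j _ hj => hother i j hj, hself]
    · exact Finset.prod_eq_one fun j hj => hother i j fun h => hi (h ▸ hj)
  ext i
  have hv := congrArg ((w i).valuation K) hy
  rw [map_mul, map_inv₀, map_pow, hprod, hprod, ← exp_neg, ← exp_add] at hv
  have hlog := congrArg log hv
  rw [log_exp, log_pow, nsmul_eq_mul] at hlog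
  push_cast at hlog
  split_ifs at hlog <;> first | tauto | omega

end NumberField

/-- **Choosing global square classes with prescribed local behaviour.**
Let `F` be a totally real number field, `v` a finite place of `F` with completion `F_v`,
`k ≥ 1`, `d₁, …, d_k ∈ F_v^×` and signs `ε₁, …, ε_k ∈ {±1}`.  Then there are
`D₁, …, D_k ∈ F^×` such that each `D_i · d_i⁻¹` is a square in `F_v^×`, each
`ε_i · τ(D_i) > 0` for every real embedding `τ : F → ℝ`, and the classes of the `D_i`
in `F^×/(F^×)²` are linearly independent over `𝔽₂`: if `(∏_{i∈S} D_i)·(∏_{i∈T} D_i)⁻¹`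
is a square in `F^×` then `S = T`. -/
theorem stmt_2 (F : Type*) [Field F] [NumberField F]
    (htotallyReal : ∀ (τ : F →+* ℂ) (x : F), (τ x).im = 0)
    (v : HeightOneSpectrum (NumberField.RingOfIntegers F))
    (k : ℕ) (hk : 1 ≤ k)
    (d : Fin k → v.adicCompletion F) (hd : ∀ i, d i ≠ 0)
    (ε : Fin k → ℝ) (hε : ∀ i, ε i = 1 ∨ ε i = -1) :
    ∃ D : Fin k → F, (∀ i, D i ≠ 0) ∧
      (∀ i, ∃ y : v.adicCompletion F, y ≠ 0 ∧
        algebraMap F (v.adicCompletion F) (D i) * (d i)⁻¹ = y ^ 2) ∧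
      (∀ (i : Fin k) (τ : F →+* ℝ), 0 < ε i * τ (D i)) ∧
      (∀ S T : Finset (Fin k),
        (∃ y : F, y ≠ 0 ∧ (∏ i ∈ S, D i) * (∏ i ∈ T, D i)⁻¹ = y ^ 2) → S = T) := by
  classical
  have := infinite_heightOneSpectrum_ringOfIntegers F
  have : Infinite ({v}ᶜ : Set (HeightOneSpectrum (𝓞 F))) :=
    (Set.finite_singleton v).infinite_compl.to_subtype
  let w (i : Fin k) : HeightOneSpectrum (𝓞 F) :=
    (Infinite.natEmbedding ({v}ᶜ : Set (HeightOneSpectrum (𝓞 F))) i : HeightOneSpectrum (𝓞 F))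
  have hwv (i) : w i ≠ v := (Infinite.natEmbedding ({v}ᶜ : Set (HeightOneSpectrum (𝓞 F))) i).2
  have hw : Function.Injective w := Subtype.val_injective.comp
    ((Infinite.natEmbedding _).injective.comp Fin.val_injective)
  have key (i : Fin k) : ∃ b : 𝓞 F,
      (∃ y : v.adicCompletion F, y ≠ 0 ∧
        algebraMap F (v.adicCompletion F) b * (d i)⁻¹ = y ^ 2) ∧
      (∀ τ : F →+* ℝ, 0 < ε i * τ b) ∧ (w i).valuation F b = exp (-1) ∧
      ∀ j, j ≠ i → (w j).valuation F b = 1 := by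
    obtain ⟨a, N, haN⟩ := exists_forall_sub_mem_pow_square_class v (hd i)
    obtain ⟨π, hπ⟩ := (w i).intValuation_exists_uniformizer
    let P : Option (Fin k) → HeightOneSpectrum (𝓞 F) := fun o => o.elim v w
    let e : Option (Fin k) → ℕ := fun o => o.elim N fun _ => 2
    let x : Option (Fin k) → 𝓞 F := fun o => o.elim a fun j => if j = i then π else 1
    have hP : Function.Injective P := by
      rintro (_ | j) (_ | l) h
      · rfl
      · exact absurd h.symm (hwv l)
      · exact absurd h (hwv j)
      · exact congrArg some (hw h)
    obtain ⟨c, hc⟩ := exists_forall_sub_mem_ideal (s := Finset.univ) (fun o => (P o).asIdeal) e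
      (fun o _ => (P o).prime) (fun o _ o' _ h h' => h (hP (HeightOneSpectrum.ext h')))
      fun o => x o
    have hI : ∏ o, (P o).asIdeal ^ e o ≠ ⊥ :=
      Finset.prod_ne_zero_iff.2 fun o _ => pow_ne_zero _ (P o).ne_bot
    obtain ⟨b, hbc, hb⟩ := exists_sub_mem_forall_sign hI c (hε i)
    have hbx (o) : b - x o ∈ (P o).asIdeal ^ e o := by
      have h1 : b - c ∈ (P o).asIdeal ^ e o :=
        Ideal.le_of_dvd (Finset.dvd_prod_of_mem _ (Finset.mem_univ o)) hbc
      simpa using add_mem h1 (hc o (Finset.mem_univ o))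
    have hval (j : Fin k) (hj : exp (-2 : ℤ) < (w j).intValuation (x (some j))) :
        (w j).valuation F b = (w j).intValuation (x (some j)) := by
      rw [HeightOneSpectrum.valuation_of_algebraMap]
      exact Valuation.map_eq_of_sub_lt _
        ((((w j).intValuation_le_pow_iff_mem _ 2).2 (hbx (some j))).trans_lt hj)
    refine ⟨b, haN b (hbx none), hb, ?_, fun j hj => ?_⟩
    · have hx : (w i).intValuation (x (some i)) = exp (-1) := by simpa [x] using hπ
      rw [hval i (by rw [hx, exp_lt_exp]; norm_num), hx]
    · have hx : (w j).intValuation (x (some j)) = 1 := by simp [x, hj]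
      rw [hval j (by rw [hx, ← exp_zero, exp_lt_exp]; norm_num), hx]
  choose b hsq hsign hself hother using key
  refine ⟨fun i => b i, fun i h => ?_, hsq, hsign, fun S T ⟨y, _, hy⟩ =>
    eq_of_prod_mul_inv_prod_eq_sq w hself (fun i j hj => hother j i hj.symm) hy⟩
  exact exp_ne_zero ((hself i).symm.trans ((Valuation.zero_iff _).2 h))
end

section
/- Let F be a totally real number field, let m ≥ 1 be an integer, for each ring homomorphism τ : F → ℝ let q_τ be an integer with 0 ≤ q_τ ≤ m, and let D ∈ F^× be an element such that for every τ : F → ℝ the real number τ(D) has sign (−1)^{q_τ}. Then there exist a₁, …, a_m ∈ F^× such that (∏_{i=1}^m a_i) · D^{−1} is a square in F^×, and for every ring homomorphism τ : F → ℝ exactly q_τ of the real numbers τ(a₁), …, τ(a_m) are negative; in particular, the diagonal quadratic form ⟨a₁, …, a_m⟩ over F has signature (m − q_τ, q_τ) after extension of scalars to ℝ along every real embedding τ of F. -/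
open NumberField

/-- The infinite place of a field attached to a real embedding determines the embedding. -/
theorem infinitePlace_mk_ofReal_comp_injective (F : Type*) [Field F] :
    Function.Injective fun τ : F →+* ℝ => InfinitePlace.mk (Complex.ofRealHom.comp τ) := by
  intro σ τ h
  ext x
  rcases InfinitePlace.mk_eq_iff.1 h with h | h <;> simpa using congr($h x)

/-- For every real embedding of a number field there is an element that is negative exactly at
this embedding. -/
theorem exists_neg_at_and_pos_of_ne {F : Type*} [Field F] [NumberField F] (σ : F →+* ℝ) :
    ∃ x : F, σ x < 0 ∧ ∀ τ : F →+* ℝ, τ ≠ σ → 0 < τ x := by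
  obtain ⟨a, ha, ha'⟩ := AbsoluteValue.exists_one_lt_lt_one_pi_of_not_isEquiv
    (v := fun v : InfinitePlace F => v.1) (fun v => v.isNontrivial)
    (fun _ _ h => InfinitePlace.eq_iff_isEquiv.not.mp h)
    (InfinitePlace.mk (Complex.ofRealHom.comp σ))
  have key (τ : F →+* ℝ) : (InfinitePlace.mk (Complex.ofRealHom.comp τ)).1 a = |τ a| := by
    rw [← InfinitePlace.coe_apply, InfinitePlace.apply]
    simp
  refine ⟨1 - a ^ 2, ?_, fun τ hτ => ?_⟩
  · rw [key] at ha
    simpa using one_lt_sq_iff_one_lt_abs _ |>.2 ha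
  · have := ha' _ ((infinitePlace_mk_ofReal_comp_injective F).ne hτ)
    rw [key] at this
    simpa using sq_lt_one_iff_abs_lt_one _ |>.2 this

/-- A number field has elements of arbitrary prescribed signs at its real embeddings. -/
theorem exists_ne_zero_forall_neg_iff {F : Type*} [Field F] [NumberField F]
    (p : (F →+* ℝ) → Prop) :
    ∃ x : F, x ≠ 0 ∧ ∀ τ : F →+* ℝ, τ x < 0 ↔ p τ := by
  classical
  have := Finite.of_injective _ (infinitePlace_mk_ofReal_comp_injective F)
  have := Fintype.ofFinite (F →+* ℝ)
  choose e he he' using exists_neg_at_and_pos_of_ne (F := F)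
  have hne (σ : F →+* ℝ) : e σ ≠ 0 := fun h => by simpa [h] using he σ
  refine ⟨∏ σ with p σ, e σ, Finset.prod_ne_zero_iff.2 fun σ _ => hne σ, fun τ => ?_⟩
  rw [map_prod]
  by_cases hp : p τ
  · rw [← Finset.mul_prod_erase _ _ (show τ ∈ Finset.univ.filter p by simpa)]
    refine iff_of_true (mul_neg_of_neg_of_pos (he τ) (Finset.prod_pos fun σ hσ => ?_)) hp
    exact he' σ τ (Finset.ne_of_mem_erase hσ).symm
  · refine iff_of_false (Finset.prod_pos fun σ hσ => he' σ τ ?_).not_gt hp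
    rintro rfl
    exact hp (Finset.mem_filter.1 hσ).2

/-- The sign of a product of nonzero elements is determined by the number of negative factors. -/
theorem neg_one_pow_card_filter_neg_mul_prod_pos {ι R : Type*} [Fintype ι] [CommRing R]
    [LinearOrder R] [IsStrictOrderedRing R] {x : ι → R} (hx : ∀ i, x i ≠ 0) :
    0 < (-1) ^ (Finset.univ.filter fun i => x i < 0).card * ∏ i, x i := by
  have : (-1 : R) ^ (Finset.univ.filter fun i => x i < 0).card =
      ∏ i, if x i < 0 then -1 else 1 := by
    simp [Finset.prod_ite]
  rw [this, ← Finset.prod_mul_distrib]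
  refine Finset.prod_pos fun i _ => ?_
  split_ifs with h
  · simpa using h
  · simpa using (not_lt.1 h).lt_of_ne' (hx i)

/-- **Diagonal quadratic forms with prescribed signatures and discriminant.**
Let `F` be a totally real number field, `m ≥ 1`, and for each real embedding
`τ : F → ℝ` let `q τ` be an integer with `0 ≤ q τ ≤ m`.  Let `D ∈ F^×` be such that
`τ(D)` has sign `(−1)^{q τ}` for every `τ`.  Then there are `a₁, …, a_m ∈ F^×`
whose product equals `D` up to a square in `F^×`, and such that for every real
embedding `τ` exactly `q τ` of the numbers `τ(a₁), …, τ(a_m)` are negative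
(hence `m − q τ` of them are positive), i.e. the diagonal form `⟨a₁, …, a_m⟩` has
signature `(m − q τ, q τ)` at every real place `τ`. -/
theorem stmt_3 (F : Type*) [Field F] [NumberField F]
    (htotallyReal : ∀ (τ : F →+* ℂ) (x : F), (τ x).im = 0)
    (m : ℕ) (hm : 1 ≤ m)
    (q : (F →+* ℝ) → ℕ) (hq : ∀ τ, q τ ≤ m)
    (D : F) (hD : D ≠ 0)
    (hsign : ∀ τ : F →+* ℝ, 0 < (-1 : ℝ) ^ (q τ) * τ D) :
    ∃ a : Fin m → F, (∀ i, a i ≠ 0) ∧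
      (∃ y : F, y ≠ 0 ∧ (∏ i, a i) * D⁻¹ = y ^ 2) ∧
      ∀ τ : F →+* ℝ,
        (Finset.univ.filter fun i => τ (a i) < 0).card = q τ ∧
        (Finset.univ.filter fun i => 0 < τ (a i)).card = m - q τ := by
  obtain ⟨k, rfl⟩ : ∃ k, m = k + 1 := ⟨m - 1, by omega⟩
  choose b hb hbneg using fun i : Fin k => exists_ne_zero_forall_neg_iff fun τ => (i : ℕ) < q τ
  let a : Fin (k + 1) → F := Fin.snoc b (D * ∏ i, b i)
  have hprod : ∏ i, b i ≠ 0 := Finset.prod_ne_zero_iff.2 fun i _ => hb i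
  have ha (i) : a i ≠ 0 := by
    refine Fin.lastCases ?_ (fun i => ?_) i
    · simpa only [a, Fin.snoc_last] using mul_ne_zero hD hprod
    · simpa [a] using hb i
  have hneg (τ : F →+* ℝ) (i : Fin (k + 1)) : τ (a i) < 0 ↔ (i : ℕ) < q τ := by
    refine Fin.lastCases ?_ (fun i => ?_) i
    · have h := neg_one_pow_card_filter_neg_mul_prod_pos fun i => (map_ne_zero τ).2 (hb i)
      simp only [hbneg, Fin.card_filter_val_lt] at h
      have h' := mul_pos h (hsign τ)
      simp only [a, Fin.snoc_last, Fin.val_last, map_mul, map_prod]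
      rcases (hq τ).lt_or_eq with hlt | heq
      · rw [min_eq_right (by omega), mul_mul_mul_comm, ← mul_pow, neg_one_mul, neg_neg, one_pow,
          one_mul, mul_comm] at h'
        exact iff_of_false h'.not_gt (by omega)
      · rw [heq, min_eq_left (by omega), mul_mul_mul_comm, pow_succ,
          ← mul_assoc (_ ^ k), ← mul_pow, neg_one_mul, neg_neg, one_pow, one_mul,
          neg_one_mul, mul_comm (∏ i, τ (b i))] at h'
        exact iff_of_true (neg_pos.1 h') (by omega)
    · simpa [a] using hbneg i τ
  refine ⟨a, ha, ⟨∏ i, b i, hprod, ?_⟩, fun τ => ?_⟩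
  · rw [Fin.prod_snoc]
    field_simp
  · have hcard : (Finset.univ.filter fun i => τ (a i) < 0).card = q τ := by
      simp [hneg, Fin.card_filter_val_lt, hq τ]
    refine ⟨hcard, ?_⟩
    have hpos (i) : 0 < τ (a i) ↔ ¬ τ (a i) < 0 := by
      rw [not_lt, le_iff_lt_or_eq, or_iff_left ((map_ne_zero τ).2 (ha i)).symm]
    simp only [hpos]
    rw [Finset.filter_not, Finset.card_sdiff_of_subset (Finset.filter_subset _ _), hcard]
    simp
end

section
/- Let G be a group and let (ρ, V) be a finite-dimensional semisimple complex representation of G equipped with a G-invariant nondegenerate symmetric bilinear form. Let W be a finite-dimensional irreducible complex representation of G of symplectic type, i.e. W carries a G-invariant nondegenerate alternating bilinear form. Then the multiplicity dim_ℂ Hom_G(W, V) of W in V is even. -/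
variable {G V W : Type*} [Group G]
  [AddCommGroup V] [Module ℂ V] [AddCommGroup W] [Module ℂ W]

/-- A submodule invariant under a representation (a subrepresentation). -/
def IsSubrep (ρ : Representation ℂ G V) (U : Submodule ℂ V) : Prop :=
  ∀ g : G, ∀ x ∈ U, ρ g x ∈ U

/-- A representation is semisimple if every subrepresentation admits an
invariant complement. -/
def IsSemisimpleRep (ρ : Representation ℂ G V) : Prop :=
  ∀ U : Submodule ℂ V, IsSubrep ρ U →
    ∃ U' : Submodule ℂ V, IsSubrep ρ U' ∧ IsCompl U U'

/-- A representation is irreducible if the space is nonzero and the only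
invariant submodules are `⊥` and `⊤`. -/
def IsIrreducibleRep (ρ : Representation ℂ G V) : Prop :=
  (∃ x : V, x ≠ 0) ∧ ∀ U : Submodule ℂ V, IsSubrep ρ U → U = ⊥ ∨ U = ⊤

/-- The space `Hom_G(W, V)` of `G`-equivariant linear maps from `(W, σ)` to `(V, ρ)`. -/
def equivariantHom (σ : Representation ℂ G W) (ρ : Representation ℂ G V) :
    Submodule ℂ (W →ₗ[ℂ] V) where
  carrier := {f | ∀ (g : G) (w : W), f (σ g w) = ρ g (f w)}
  add_mem' := by
    intro f h hf hh g w
    simp only [LinearMap.add_apply, hf g w, hh g w, map_add]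
  zero_mem' := by
    intro g w
    simp
  smul_mem' := by
    intro c f hf g w
    simp only [LinearMap.smul_apply, hf g w, map_smul]

open LinearMap in
/-- A finite-dimensional space carrying a nondegenerate alternating form is even-dimensional. -/
theorem even_finrank_of_isAlt_of_separatingLeft {K E : Type*} [Field K] [CharZero K]
    [AddCommGroup E] [Module K E] [FiniteDimensional K E] (ω : E →ₗ[K] E →ₗ[K] K)
    (halt : ω.IsAlt) (hnd : ω.SeparatingLeft) : Even (Module.finrank K E) := by
  let b := Module.finBasis K E
  have hdet := (separatingLeft_iff_det_ne_zero b).mp hnd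
  have htr : (toMatrix₂ b b ω).transpose = -toMatrix₂ b b ω := by
    ext i j
    simp only [Matrix.transpose_apply, Matrix.neg_apply, toMatrix₂_apply]
    exact (halt.neg _ _).symm
  have h := congrArg Matrix.det htr
  rw [Matrix.det_transpose, Matrix.det_neg, Fintype.card_fin] at h
  by_contra hodd
  rw [(Nat.not_even_iff_odd.mp hodd).neg_one_pow, neg_one_mul] at h
  exact hdet (self_eq_neg.mp h)

/-- The isomorphism onto the dual space induced by a left-separating bilinear form. -/
noncomputable def dualEquivOfSeparatingLeft {K E : Type*} [Field K]
    [AddCommGroup E] [Module K E] [FiniteDimensional K E] (B : E →ₗ[K] E →ₗ[K] K)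
    (hB : ∀ x, (∀ y, B x y = 0) → x = 0) : E ≃ₗ[K] Module.Dual K E :=
  B.linearEquivOfInjective
    ((injective_iff_map_eq_zero B).mpr fun x hx => hB x fun y => by rw [hx]; rfl)
    Subspace.dual_finrank_eq.symm

theorem apply_dualEquivOfSeparatingLeft_symm {K E : Type*} [Field K]
    [AddCommGroup E] [Module K E] [FiniteDimensional K E] (B : E →ₗ[K] E →ₗ[K] K)
    (hB : ∀ x, (∀ y, B x y = 0) → x = 0) (φ : Module.Dual K E) (y : E) :
    B ((dualEquivOfSeparatingLeft B hB).symm φ) y = φ y :=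
  LinearMap.congr_fun ((dualEquivOfSeparatingLeft B hB).apply_symm_apply φ) y

theorem apply_inv_left_of_invariant {ρ : Representation ℂ G V} {B : V →ₗ[ℂ] V →ₗ[ℂ] ℂ}
    (hB : ∀ (g : G) (x y : V), B (ρ g x) (ρ g y) = B x y) (g : G) (x y : V) :
    B x (ρ g⁻¹ y) = B (ρ g x) y := by
  rw [← hB g, Representation.self_inv_apply]

/-- **Schur's lemma**: an equivariant endomorphism of an irreducible representation is scalar. -/
theorem IsIrreducibleRep.exists_eq_smul [FiniteDimensional ℂ W] {σ : Representation ℂ G W}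
    (hσ : IsIrreducibleRep σ) {T : W →ₗ[ℂ] W} (hT : T ∈ equivariantHom σ σ) :
    ∃ c : ℂ, ∀ x, T x = c • x := by
  obtain ⟨⟨x₀, hx₀⟩, hsub⟩ := hσ
  have : Nontrivial W := ⟨⟨x₀, 0, hx₀⟩⟩
  obtain ⟨c, hc⟩ := Module.End.exists_eigenvalue T
  refine ⟨c, fun x => ?_⟩
  have htop := (hsub (Module.End.eigenspace T c) fun g x hx => by
    rw [Module.End.mem_eigenspace_iff] at hx ⊢
    rw [hT g x, hx, map_smul]).resolve_left hc
  exact Module.End.mem_eigenspace_iff.mp (htop ▸ Submodule.mem_top)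

/-- On an irreducible representation an invariant nondegenerate bilinear form is unique up to a
scalar. -/
theorem IsIrreducibleRep.exists_form_eq_mul [FiniteDimensional ℂ W] {σ : Representation ℂ G W}
    (hσ : IsIrreducibleRep σ) {C D : W →ₗ[ℂ] W →ₗ[ℂ] ℂ}
    (hCinv : ∀ (g : G) (x y : W), C (σ g x) (σ g y) = C x y)
    (hCnd : ∀ x : W, (∀ y : W, C x y = 0) → x = 0)
    (hDinv : ∀ (g : G) (x y : W), D (σ g x) (σ g y) = D x y) :
    ∃ c : ℂ, ∀ x y, D x y = c * C x y := by
  let T : W →ₗ[ℂ] W := (dualEquivOfSeparatingLeft C hCnd).symm.toLinearMap ∘ₗ D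
  have hT (x y : W) : C (T x) y = D x y :=
    apply_dualEquivOfSeparatingLeft_symm C hCnd (D x) y
  obtain ⟨c, hc⟩ := hσ.exists_eq_smul (T := T) fun g x => by
    rw [← sub_eq_zero]
    refine hCnd _ fun y => ?_
    rw [map_sub, LinearMap.sub_apply, hT, ← apply_inv_left_of_invariant hCinv, hT,
      apply_inv_left_of_invariant hDinv, sub_self]
  refine ⟨c, fun x y => ?_⟩
  rw [← hT, hc, map_smul, LinearMap.smul_apply, smul_eq_mul]

/-- A nonzero equivariant map from an irreducible representation to a semisimple one has an
equivariant left inverse. -/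
theorem IsSemisimpleRep.exists_leftInverse {ρ : Representation ℂ G V} {σ : Representation ℂ G W}
    (hρ : IsSemisimpleRep ρ) (hσ : IsIrreducibleRep σ) {f : W →ₗ[ℂ] V}
    (hf : f ∈ equivariantHom σ ρ) (hf0 : f ≠ 0) :
    ∃ p ∈ equivariantHom ρ σ, ∀ x, p (f x) = x := by
  have hker : LinearMap.ker f = ⊥ := by
    refine (hσ.2 (LinearMap.ker f) fun g x hx => ?_).resolve_right
      fun h => hf0 (LinearMap.ker_eq_top.mp h)
    rw [LinearMap.mem_ker] at hx ⊢
    rw [hf g x, hx, map_zero]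
  have hinj : Function.Injective f := LinearMap.ker_eq_bot.mp hker
  obtain ⟨U, hU, hc⟩ := hρ (LinearMap.range f) (by
    rintro g _ ⟨x, rfl⟩
    exact ⟨σ g x, hf g x⟩)
  let e := LinearEquiv.ofInjective f hinj
  let p : V →ₗ[ℂ] W := e.symm.toLinearMap ∘ₗ (LinearMap.range f).projectionOnto U hc
  have hpf (x : W) : p (f x) = x := by
    have h : (LinearMap.range f).projectionOnto U hc (f x) = e x :=
      Submodule.projectionOnto_apply_left hc (e x)
    simp only [p, LinearMap.comp_apply, h, LinearEquiv.coe_coe, e.symm_apply_apply]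
  have hpU (u : V) (hu : u ∈ U) : p u = 0 := by
    have h : (LinearMap.range f).projectionOnto U hc u = 0 :=
      Submodule.projectionOnto_apply_right hc ⟨u, hu⟩
    simp only [p, LinearMap.comp_apply, h, map_zero]
  refine ⟨p, fun g v => ?_, hpf⟩
  obtain ⟨_, ⟨x, rfl⟩, u, hu, rfl⟩ :=
    Submodule.mem_sup.mp (hc.sup_eq_top ▸ Submodule.mem_top (x := v))
  rw [map_add, map_add, map_add, ← hf g x, hpf, hpf, hpU u hu, hpU _ (hU g u hu), add_zero,
    add_zero]

/-- An equivariant map has an equivariant adjoint with respect to invariant forms. -/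
theorem exists_equivariant_adjoint [FiniteDimensional ℂ V]
    {ρ : Representation ℂ G V} {σ : Representation ℂ G W}
    {B : V →ₗ[ℂ] V →ₗ[ℂ] ℂ} (hBinv : ∀ (g : G) (x y : V), B (ρ g x) (ρ g y) = B x y)
    (hBnd : ∀ x : V, (∀ y : V, B x y = 0) → x = 0)
    {C : W →ₗ[ℂ] W →ₗ[ℂ] ℂ} (hCinv : ∀ (g : G) (x y : W), C (σ g x) (σ g y) = C x y)
    {p : V →ₗ[ℂ] W} (hp : p ∈ equivariantHom ρ σ) :
    ∃ h ∈ equivariantHom σ ρ, ∀ w v, B (h w) v = C w (p v) := by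
  let h : W →ₗ[ℂ] V := (dualEquivOfSeparatingLeft B hBnd).symm.toLinearMap ∘ₗ C.compl₂ p
  have hh (w : W) (v : V) : B (h w) v = C w (p v) :=
    apply_dualEquivOfSeparatingLeft_symm B hBnd (C.compl₂ p w) v
  refine ⟨h, fun g w => ?_, hh⟩
  rw [← sub_eq_zero]
  refine hBnd _ fun v => ?_
  rw [map_sub, LinearMap.sub_apply, hh, ← apply_inv_left_of_invariant hBinv, hh, hp,
    apply_inv_left_of_invariant hCinv, sub_self]

/-- **Multiplicities of symplectic-type irreducibles in an orthogonal representation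
are even.**  If `(ρ, V)` is a finite-dimensional semisimple complex representation of `G`
carrying a `G`-invariant nondegenerate *symmetric* bilinear form, and `(σ, W)` is a
finite-dimensional irreducible complex representation of `G` of symplectic type (i.e.
carrying a `G`-invariant nondegenerate alternating bilinear form), then the multiplicity
`dim Hom_G(W, V)` is even. -/
theorem stmt_7 [FiniteDimensional ℂ V] [FiniteDimensional ℂ W]
    (ρ : Representation ℂ G V) (σ : Representation ℂ G W)
    (hss : IsSemisimpleRep ρ)
    (B : V →ₗ[ℂ] V →ₗ[ℂ] ℂ)
    (hBinv : ∀ (g : G) (x y : V), B (ρ g x) (ρ g y) = B x y)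
    (hBnd : ∀ x : V, (∀ y : V, B x y = 0) → x = 0)
    (hBsymm : ∀ x y : V, B x y = B y x)
    (hWirr : IsIrreducibleRep σ)
    (C : W →ₗ[ℂ] W →ₗ[ℂ] ℂ)
    (hCinv : ∀ (g : G) (x y : W), C (σ g x) (σ g y) = C x y)
    (hCnd : ∀ x : W, (∀ y : W, C x y = 0) → x = 0)
    (hCalt : ∀ x : W, C x x = 0) :
    Even (Module.finrank ℂ (equivariantHom σ ρ)) := by
  obtain ⟨x₀, hx₀⟩ := hWirr.1
  obtain ⟨y₀, hy₀⟩ : ∃ y, C x₀ y ≠ 0 := by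
    by_contra! h
    exact hx₀ (hCnd x₀ h)
  let ι := (equivariantHom σ ρ).subtype
  let ω : equivariantHom σ ρ →ₗ[ℂ] equivariantHom σ ρ →ₗ[ℂ] ℂ :=
    B.compl₁₂ (LinearMap.applyₗ x₀ ∘ₗ ι) (LinearMap.applyₗ y₀ ∘ₗ ι)
  have hω (f h : equivariantHom σ ρ) : ω f h = B (f.1 x₀) (h.1 y₀) := rfl
  refine even_finrank_of_isAlt_of_separatingLeft ω (fun f => ?_) fun f hf => ?_
  · obtain ⟨c, hc⟩ := hWirr.exists_form_eq_mul (D := B.compl₁₂ f.1 f.1) hCinv hCnd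
      fun g x y => by simp only [LinearMap.compl₁₂_apply, f.2 g x, f.2 g y, hBinv]
    simp only [LinearMap.compl₁₂_apply] at hc
    have hskew : -C x₀ y₀ = C y₀ x₀ := LinearMap.IsAlt.neg hCalt x₀ y₀
    have h : B (f.1 x₀) (f.1 y₀) = -B (f.1 x₀) (f.1 y₀) := by
      conv_lhs => rw [hBsymm, hc, ← hskew, mul_neg, ← hc]
    exact self_eq_neg.mp h
  · by_contra hf0
    obtain ⟨p, hp, hpf⟩ := hss.exists_leftInverse hWirr f.2 (by simpa using hf0)
    obtain ⟨h, hh, hadj⟩ := exists_equivariant_adjoint hBinv hBnd hCinv hp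
    have h0 := hf ⟨h, hh⟩
    rw [hω, hBsymm, hadj, hpf, ← LinearMap.IsAlt.neg hCalt, neg_eq_zero] at h0
    exact hy₀ h0
end

section
/- Let F be a number field, let S be a finite set of finite places of F, let d_v ∈ F_v^× be given for each v ∈ S, and let a sign s_τ ∈ {+1, −1} be given for each ring homomorphism τ : F → ℝ. Then there exists D ∈ F^× such that D · d_v^{−1} is a square in F_v^× for every v ∈ S, and the real number τ(D) has sign s_τ for every ring homomorphism τ : F → ℝ. -/
open IsDedekindDomain

open NumberField Topology

/-- In a complete nontrivially normed field with `2 ≠ 0`, the nonzero squares form a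
neighbourhood of `1`. -/
theorem eventually_nhds_one_exists_eq_sq {𝕜 : Type*} [NontriviallyNormedField 𝕜] [CompleteSpace 𝕜]
    (h2 : (2 : 𝕜) ≠ 0) : ∀ᶠ x in 𝓝 (1 : 𝕜), ∃ y : 𝕜, y ≠ 0 ∧ x = y ^ 2 := by
  have hderiv : HasStrictDerivAt (fun y : 𝕜 ↦ y ^ 2) 2 1 := by
    simpa using hasStrictDerivAt_pow 2 (1 : 𝕜)
  have hmap := hderiv.map_nhds_eq h2
  rw [one_pow] at hmap
  rw [← hmap, Filter.eventually_map]
  filter_upwards [isOpen_ne.mem_nhds (one_ne_zero (α := 𝕜))] with y hy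
  exact ⟨y, hy, rfl⟩

namespace NumberField

variable {F : Type*} [Field F]

/-- The infinite place attached to a real embedding. -/
noncomputable def InfinitePlace.ofReal (τ : F →+* ℝ) : InfinitePlace F :=
  InfinitePlace.mk (Complex.ofRealHom.comp τ)

theorem InfinitePlace.ofReal_apply (τ : F →+* ℝ) (x : F) : ofReal τ x = |τ x| := by
  simp [ofReal]

theorem InfinitePlace.ofReal_injective :
    Function.Injective (ofReal : (F →+* ℝ) → InfinitePlace F) := by
  intro τ σ h
  ext x
  rcases InfinitePlace.mk_eq_iff.mp h with h | h
  · simpa using RingHom.congr_fun h x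
  · simpa using RingHom.congr_fun h x

variable [NumberField F]

theorem HeightOneSpectrum.isNontrivial_adicAbv (v : HeightOneSpectrum (𝓞 F)) :
    (HeightOneSpectrum.adicAbv F v).IsNontrivial := by
  obtain ⟨x, hx, hx0⟩ := v.asIdeal.ne_bot_iff.mp v.ne_bot
  refine ⟨algebraMap (𝓞 F) F x, by simpa using hx0, ne_of_lt ?_⟩
  exact (v.adicAbv_coe_lt_one_iff (HeightOneSpectrum.one_lt_absNorm_nnreal v) x).mpr hx

theorem HeightOneSpectrum.eq_of_isEquiv_adicAbv {v w : HeightOneSpectrum (𝓞 F)}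
    (h : (HeightOneSpectrum.adicAbv F v).IsEquiv (HeightOneSpectrum.adicAbv F w)) : v = w := by
  ext x
  rw [← v.adicAbv_coe_lt_one_iff (K := F) (HeightOneSpectrum.one_lt_absNorm_nnreal v) x,
    ← w.adicAbv_coe_lt_one_iff (K := F) (HeightOneSpectrum.one_lt_absNorm_nnreal w) x]
  exact h.lt_one_iff

theorem not_isEquiv_adicAbv_infinitePlace (v : HeightOneSpectrum (𝓞 F)) (w : InfinitePlace F) :
    ¬ (HeightOneSpectrum.adicAbv F v).IsEquiv w.1 := by
  intro h
  have h2 : w.1 ((2 : ℕ) : F) ≤ 1 :=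
    h.le_one_iff.mp (HeightOneSpectrum.adicAbv_natCast_le_one F v 2)
  have : w.1 ((2 : ℕ) : F) = 2 := by
    rw [← InfinitePlace.coe_apply, ← InfinitePlace.norm_embedding_eq, map_natCast]
    simp
  linarith

/-- **Weak approximation** at finitely many finite places and all infinite places. -/
theorem exists_approx_finite_infinite (S : Finset (HeightOneSpectrum (𝓞 F)))
    (c : ∀ v : HeightOneSpectrum (𝓞 F), v.adicCompletion F) (e : InfinitePlace F → F)
    {ε : HeightOneSpectrum (𝓞 F) → ℝ} (hε : ∀ v ∈ S, 0 < ε v) {δ : InfinitePlace F → ℝ}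
    (hδ : ∀ w, 0 < δ w) :
    ∃ D : F, (∀ v ∈ S, ‖algebraMap F (v.adicCompletion F) D - c v‖ < ε v) ∧
      ∀ w : InfinitePlace F, w (D - e w) < δ w := by
  have hc (v : S) : ∃ x : F, ‖algebraMap F (v.1.adicCompletion F) x - c v‖ < ε v / 2 := by
    obtain ⟨x, hx⟩ := (v.1.denseRange_algebraMap F).mem_nhds
      (Metric.ball_mem_nhds (c v) (half_pos (hε v v.2)))
    exact ⟨x, by simpa [dist_eq_norm] using hx⟩
  choose x hx using hc
  let abv : S ⊕ InfinitePlace F → AbsoluteValue F ℝ :=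
    Sum.elim (fun v ↦ HeightOneSpectrum.adicAbv F v.1) (fun w ↦ w.1)
  let r : S ⊕ InfinitePlace F → ℝ := Sum.elim (fun v ↦ ε v / 2) δ
  have hr (i) : 0 < r i := by
    rcases i with v | w
    · exact half_pos (hε v v.2)
    · exact hδ w
  have hdense : DenseRange <| algebraMap F ((i : S ⊕ InfinitePlace F) → WithAbs (abv i)) := by
    refine AbsoluteValue.denseRange_algebraMap_pi ?_ ?_
    · rintro (v | w)
      · exact HeightOneSpectrum.isNontrivial_adicAbv v.1
      · exact w.isNontrivial
    · rintro (v | w) (v' | w') hne h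
      · exact hne (congrArg _ (Subtype.ext (HeightOneSpectrum.eq_of_isEquiv_adicAbv h)))
      · exact not_isEquiv_adicAbv_infinitePlace v.1 w' h
      · exact not_isEquiv_adicAbv_infinitePlace v'.1 w h.symm
      · exact hne (congrArg _ (InfinitePlace.eq_iff_isEquiv.mpr h))
  obtain ⟨D, hD⟩ := hdense.mem_nhds (set_pi_mem_nhds Set.finite_univ fun i _ ↦
    Metric.ball_mem_nhds (WithAbs.toAbs (abv i) (Sum.elim x e i)) (hr i))
  have key (i) : abv i (D - Sum.elim x e i) < r i := by
    have := hD i trivial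
    rwa [Metric.mem_ball, dist_eq_norm] at this
  refine ⟨D, fun v hv ↦ ?_, fun w ↦ key (.inr w)⟩
  have h1 : ‖algebraMap F (v.adicCompletion F) (D - x ⟨v, hv⟩)‖ < ε v / 2 :=
    (FinitePlace.norm_embedding v _).trans_lt (key (.inl ⟨v, hv⟩))
  calc ‖algebraMap F (v.adicCompletion F) D - c v‖
      = ‖algebraMap F (v.adicCompletion F) (D - x ⟨v, hv⟩)
          + (algebraMap F (v.adicCompletion F) (x ⟨v, hv⟩) - c v)‖ := by
        rw [map_sub, sub_add_sub_cancel]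
    _ < ε v / 2 + ε v / 2 := (norm_add_le _ _).trans_lt (add_lt_add h1 (hx ⟨v, hv⟩))
    _ = ε v := add_halves _

theorem eventually_nhds_mul_inv_eq_sq (v : HeightOneSpectrum (𝓞 F)) {d : v.adicCompletion F}
    (hd : d ≠ 0) : ∀ᶠ x in 𝓝 d, ∃ y : v.adicCompletion F, y ≠ 0 ∧ x * d⁻¹ = y ^ 2 := by
  obtain ⟨a, ha0, ha⟩ := HeightOneSpectrum.isNontrivial_adicAbv v
  let _ : NontriviallyNormedField (v.adicCompletion F) :=
    NontriviallyNormedField.ofNormNeOne ⟨algebraMap F _ a, by simpa using ha0,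
      fun h ↦ ha ((FinitePlace.norm_embedding v a).symm.trans h)⟩
  have h2 : (2 : v.adicCompletion F) ≠ 0 := by
    rw [← map_ofNat (algebraMap F (v.adicCompletion F)) 2]
    simp
  have ht : Filter.Tendsto (fun x ↦ x * d⁻¹) (𝓝 d) (𝓝 1) := by
    simpa [hd] using (continuous_mul_const d⁻¹).tendsto d
  exact ht.eventually (eventually_nhds_one_exists_eq_sq h2)

end NumberField

/-- **Weak approximation for square classes.**
Let `F` be a number field, `S` a finite set of finite places of `F`, `d_v ∈ F_v^×` for
each `v ∈ S`, and a sign `s_τ ∈ {±1}` for each real embedding `τ : F → ℝ`.  Then there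
exists `D ∈ F^×` such that `D · d_v⁻¹` is a square in `F_v^×` for every `v ∈ S`, and
`τ(D)` has sign `s_τ` for every `τ`. -/
theorem stmt_10 (F : Type*) [Field F] [NumberField F]
    (S : Finset (HeightOneSpectrum (NumberField.RingOfIntegers F)))
    (d : ∀ v : HeightOneSpectrum (NumberField.RingOfIntegers F), v.adicCompletion F)
    (hd : ∀ v ∈ S, d v ≠ 0)
    (s : (F →+* ℝ) → ℝ) (hs : ∀ τ, s τ = 1 ∨ s τ = -1) :
    ∃ D : F, D ≠ 0 ∧
      (∀ v ∈ S, ∃ y : v.adicCompletion F, y ≠ 0 ∧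
        algebraMap F (v.adicCompletion F) D * (d v)⁻¹ = y ^ 2) ∧
      ∀ τ : F →+* ℝ, 0 < s τ * τ D := by
  have hsq (v : HeightOneSpectrum (𝓞 F)) : ∃ ε : ℝ, 0 < ε ∧ (v ∈ S → ∀ x, ‖x - d v‖ < ε →
      ∃ y : v.adicCompletion F, y ≠ 0 ∧ x * (d v)⁻¹ = y ^ 2) := by
    by_cases hv : v ∈ S
    · obtain ⟨ε, hε, h⟩ := Metric.eventually_nhds_iff.mp
        (eventually_nhds_mul_inv_eq_sq v (hd v hv))
      exact ⟨ε, hε, fun _ x hx ↦ h (by rwa [dist_eq_norm])⟩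
    · exact ⟨1, one_pos, fun h ↦ absurd h hv⟩
  choose ε hε hsq using hsq
  have hsign (τ : F →+* ℝ) : ∃ e : F, τ e = s τ := by
    rcases hs τ with h | h
    · exact ⟨1, by simp [h]⟩
    · exact ⟨-1, by simp [h]⟩
  choose e he using hsign
  obtain ⟨D, hDfin, hDinf⟩ := exists_approx_finite_infinite S d
    (Function.extend InfinitePlace.ofReal e (-1)) (fun v _ ↦ hε v) (δ := 1) (fun _ ↦ one_pos)
  have hDsign (τ : F →+* ℝ) : 0 < s τ * τ D := by
    have h := hDinf (InfinitePlace.ofReal τ)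
    rw [InfinitePlace.ofReal_injective.extend_apply, InfinitePlace.ofReal_apply, map_sub, he,
      Pi.one_apply, abs_lt] at h
    rcases hs τ with hτ | hτ <;> rw [hτ] at h ⊢ <;> linarith
  refine ⟨D, ?_, fun v hv ↦ hsq v hv _ (hDfin v hv), hDsign⟩
  rintro rfl
  obtain ⟨w⟩ : Nonempty (InfinitePlace F) := inferInstance
  by_cases hw : ∃ τ, InfinitePlace.ofReal τ = w
  · obtain ⟨τ, -⟩ := hw
    simpa using hDsign τ
  · have h := hDinf w
    rw [Function.extend_apply' _ _ _ hw] at h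
    simp at h
end
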